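/- Suppose a pure state ψ on registers Q₁A₁⋯Q_kA_k passes the uniformity test with parameters (K', Q, k, η) with probability 1. Then there exists a collection 𝒮 of subsets of {1,…,k} such that (1) every T ∈ 𝒮 satisfies |T| ≥ (k/K')(1−η), and (2) the probability distribution μ_Q obtained by measuring all k question registers of ψ in the standard basis decomposes as μ_Q = Σ_{T∈𝒮} p(T) · μ^{unif}_T ⊗ μ^{junk}_{T̄}, where p is a probability distribution on 𝒮, μ^{unif}_T is the uniform distribution over [Q]^{|T|} on the coordinates in T, and μ^{junk}_{T̄} is some (arbitrary) distribution on the coordinates in {1,…,k}∖T. -/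

import Mathlib

open scoped BigOperators Classical

/-- Amplitude `⟨t | F_K | s⟩` of the quantum Fourier transform on `ℂ^K`. -/
noncomputable def fourierAmp (K : ℕ) (s t : ℕ) : ℂ :=
  Complex.exp (2 * Real.pi * Complex.I * s * t / K) / Real.sqrt K

/-- Overlap of ψ with the basis vector indexed by `(r, q̄)`, where the answer registers carry the
Fourier basis vector `r`, the question registers `i` with `r i = 0` carry the zero Fourier state
(`q̄ i` is forced to be `0` there), and the remaining question registers carry `|q̄ i⟩`. -/
noncomputable def unifOverlap (K' Q k : ℕ) (r : Fin k → Fin K') (qbar : Fin k → Fin Q)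
    (ψ : (Fin k → Fin Q) → (Fin k → Fin K') → ℂ) : ℂ :=
  ∑ q : Fin k → Fin Q, ∑ a : Fin k → Fin K',
    ψ q a * (∏ i, (starRingEnd ℂ) (fourierAmp K' (r i) (a i)))
      * (∏ i, if (r i : ℕ) = 0 then
            (starRingEnd ℂ) (fourierAmp Q 0 (q i)) * (if (qbar i : ℕ) = 0 then 1 else 0)
          else (if q i = qbar i then 1 else 0))

/-- Probability that ψ passes the uniformity test with parameters `(K', Q, k, η)`:
step 1 measures all answer registers in the Fourier basis obtaining `r`; step 2 rejects unless
the number of zero outcomes is at least `(1-η)k/K'`; step 3 measures the question registers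
indexed by the zero set in the Fourier basis and accepts iff all those outcomes are `0`. -/
noncomputable def unifPassProb (K' Q k : ℕ) (η : ℝ)
    (ψ : (Fin k → Fin Q) → (Fin k → Fin K') → ℂ) : ℝ :=
  ∑ r : Fin k → Fin K',
    if ((1 - η) / (K' : ℝ) * k ≤ ((Finset.univ.filter fun i => (r i : ℕ) = 0).card : ℝ)) then
      ∑ qbar : Fin k → Fin Q, Complex.normSq (unifOverlap K' Q k r qbar ψ)
    else 0

/-- The distribution obtained by measuring all question registers of ψ in the standard basis. -/
noncomputable def questionDist {K' Q k : ℕ}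
    (ψ : (Fin k → Fin Q) → (Fin k → Fin K') → ℂ) (q : Fin k → Fin Q) : ℝ :=
  ∑ a : Fin k → Fin K', Complex.normSq (ψ q a)

open ComplexConjugate

/-- Parseval's identity for a finite family `w` satisfying the completeness relation. -/
theorem sum_normSq_eq_of_complete {α β : Type*} [Fintype α] [DecidableEq α] [Fintype β]
    (w : β → α → ℂ) (hw : ∀ a a', ∑ b, w b a * conj (w b a') = if a = a' then 1 else 0)
    (f : α → ℂ) :
    ∑ b, Complex.normSq (∑ a, f a * w b a) = ∑ a, Complex.normSq (f a) := by
  have key : ∑ b, (∑ a, f a * w b a) * conj (∑ a, f a * w b a) = ∑ a, f a * conj (f a) := by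
    calc ∑ b, (∑ a, f a * w b a) * conj (∑ a, f a * w b a)
        = ∑ b, ∑ a, ∑ a', f a * conj (f a') * (w b a * conj (w b a')) := by
          refine Finset.sum_congr rfl fun b _ => ?_
          rw [map_sum, Finset.sum_mul_sum]
          refine Finset.sum_congr rfl fun a _ => Finset.sum_congr rfl fun a' _ => ?_
          rw [map_mul]; ring
      _ = ∑ a, ∑ a', f a * conj (f a') * ∑ b, w b a * conj (w b a') := by
          rw [Finset.sum_comm]
          refine Finset.sum_congr rfl fun a _ => ?_
          rw [Finset.sum_comm]
          simp only [Finset.mul_sum]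
      _ = ∑ a, f a * conj (f a) := by simp [hw]
  simp only [Complex.mul_conj] at key
  exact_mod_cast key

/-- The residual in Bessel's inequality, for an orthogonal family of vectors `u b` of squared
norm `e b`, where `e b = 1` whenever `f` has a nonzero coefficient along `u b`. -/
theorem sum_normSq_sub_projection {α β : Type*} [Fintype α] [Fintype β] [DecidableEq β]
    (u : β → α → ℂ) (e : β → ℂ)
    (hu : ∀ b b', ∑ a, u b a * conj (u b' a) = if b = b' then e b else 0)
    (f : α → ℂ) (he : ∀ b, e b * ∑ a, f a * conj (u b a) = ∑ a, f a * conj (u b a)) :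
    ∑ a, Complex.normSq (f a - ∑ b, (∑ a', f a' * conj (u b a')) * u b a) =
      ∑ a, Complex.normSq (f a) - ∑ b, Complex.normSq (∑ a, f a * conj (u b a)) := by
  set c : β → ℂ := fun b => ∑ a, f a * conj (u b a) with hc
  have cross : ∑ a, f a * conj (∑ b, c b * u b a) = ∑ b, c b * conj (c b) := by
    simp only [map_sum, map_mul, Finset.mul_sum]
    rw [Finset.sum_comm]
    refine Finset.sum_congr rfl fun b _ => ?_
    conv_rhs => rw [mul_comm, hc]
    simp only [Finset.mul_sum]
    exact Finset.sum_congr rfl fun a _ => by ring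
  have cross' : ∑ a, (∑ b, c b * u b a) * conj (f a) = ∑ b, c b * conj (c b) := by
    have := congrArg conj cross
    simp only [map_sum, map_mul, Complex.conj_conj] at this ⊢
    simpa only [mul_comm] using this
  have square : ∑ a, (∑ b, c b * u b a) * conj (∑ b, c b * u b a) = ∑ b, c b * conj (c b) := by
    calc ∑ a, (∑ b, c b * u b a) * conj (∑ b, c b * u b a)
        = ∑ a, ∑ b, ∑ b', c b * conj (c b') * (u b a * conj (u b' a)) := by
          refine Finset.sum_congr rfl fun a _ => ?_
          rw [map_sum, Finset.sum_mul_sum]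
          refine Finset.sum_congr rfl fun b _ => Finset.sum_congr rfl fun b' _ => ?_
          rw [map_mul]; ring
      _ = ∑ b, ∑ b', c b * conj (c b') * ∑ a, u b a * conj (u b' a) := by
          rw [Finset.sum_comm]
          refine Finset.sum_congr rfl fun b _ => ?_
          rw [Finset.sum_comm]
          simp only [Finset.mul_sum]
      _ = ∑ b, c b * conj (c b) := by
          simp only [hu, mul_ite, mul_zero, Finset.sum_ite_eq, Finset.mem_univ, if_true]
          refine Finset.sum_congr rfl fun b _ => ?_
          have hb : e b * c b = c b := he b
          rw [mul_right_comm, mul_comm (c b) (e b), hb]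
  have key : ∑ a, (f a - ∑ b, c b * u b a) * conj (f a - ∑ b, c b * u b a) =
      ∑ a, f a * conj (f a) - ∑ b, c b * conj (c b) := by
    have expand : ∀ a, (f a - ∑ b, c b * u b a) * conj (f a - ∑ b, c b * u b a) =
        f a * conj (f a) - f a * conj (∑ b, c b * u b a) - (∑ b, c b * u b a) * conj (f a)
          + (∑ b, c b * u b a) * conj (∑ b, c b * u b a) := fun a => by
      rw [map_sub]; ring
    simp only [expand, Finset.sum_add_distrib, Finset.sum_sub_distrib]
    rw [cross, cross', square]; ring
  simp only [Complex.mul_conj] at key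
  exact_mod_cast key

theorem fourierAmp_eq_pow (K s t : ℕ) :
    fourierAmp K s t = (Complex.exp (2 * Real.pi * Complex.I / K) ^ t) ^ s / Real.sqrt K := by
  rw [fourierAmp, ← pow_mul, ← Complex.exp_nat_mul]
  congr 2
  push_cast
  ring

theorem fourierAmp_zero_left (K t : ℕ) : fourierAmp K 0 t = 1 / Real.sqrt K := by
  simp [fourierAmp]

theorem sqrt_mul_sqrt_natCast (K : ℕ) : (Real.sqrt K : ℂ) * Real.sqrt K = K := by
  rw [← Complex.ofReal_mul, Real.mul_self_sqrt (Nat.cast_nonneg K), Complex.ofReal_natCast]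

/-- The rows of the quantum Fourier transform are complete. -/
theorem sum_conj_fourierAmp_mul (K : ℕ) (hK : 0 < K) (a a' : Fin K) :
    ∑ r : Fin K, conj (fourierAmp K r a) * fourierAmp K r a' = if a = a' then 1 else 0 := by
  have hK0 : (K : ℂ) ≠ 0 := by exact_mod_cast hK.ne'
  set ζ := Complex.exp (2 * Real.pi * Complex.I / K) with hζ
  have prim : IsPrimitiveRoot ζ K := Complex.isPrimitiveRoot_exp K hK.ne'
  have hconj : conj ζ * ζ = 1 := by
    rw [Complex.conj_mul', IsPrimitiveRoot.norm'_eq_one prim hK.ne']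
    simp
  have hterm : ∀ r : Fin K, conj (fourierAmp K r a) * fourierAmp K r a' =
      (conj ζ ^ (a : ℕ) * ζ ^ (a' : ℕ)) ^ (r : ℕ) / K := fun r => by
    rw [fourierAmp_eq_pow, fourierAmp_eq_pow, ← hζ, map_div₀, map_pow, map_pow,
      Complex.conj_ofReal, div_mul_div_comm, sqrt_mul_sqrt_natCast, mul_pow]
  simp only [hterm]
  rw [← Finset.sum_div, Fin.sum_univ_eq_sum_range (fun r => (conj ζ ^ (a : ℕ) * ζ ^ (a' : ℕ)) ^ r)]
  split_ifs with h
  · subst h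
    rw [← mul_pow, hconj]
    simp [hK0]
  · have hne : conj ζ ^ (a : ℕ) * ζ ^ (a' : ℕ) ≠ 1 := fun h1 => by
      have h2 : ζ ^ (a' : ℕ) = ζ ^ (a : ℕ) := by
        calc ζ ^ (a' : ℕ) = (conj ζ * ζ) ^ (a : ℕ) * ζ ^ (a' : ℕ) := by rw [hconj]; simp
          _ = ζ ^ (a : ℕ) * (conj ζ ^ (a : ℕ) * ζ ^ (a' : ℕ)) := by rw [mul_pow]; ring
          _ = ζ ^ (a : ℕ) := by rw [h1, mul_one]
      exact h (Fin.ext (prim.pow_inj a'.2 a.2 h2).symm)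
    have hroot : (conj ζ ^ (a : ℕ) * ζ ^ (a' : ℕ)) ^ K = 1 := by
      rw [mul_pow, ← pow_mul, ← pow_mul, mul_comm _ K, mul_comm _ K, pow_mul, pow_mul, ← map_pow,
        prim.pow_eq_one]
      simp
    rw [geom_sum_eq hne, hroot]
    simp

/-- Sums of products of one-coordinate kernels factor over the coordinates. -/
theorem sum_prod_mul_prod {ι α : Type*} [Fintype ι] [DecidableEq ι] [Fintype α]
    (x y : ι → α → ℂ) :
    ∑ q : ι → α, (∏ i, x i (q i)) * (∏ i, y i (q i)) = ∏ i, ∑ c, x i c * y i c := by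
  simp only [← Finset.prod_mul_distrib]
  rw [Finset.prod_univ_sum, Fintype.piFinset_univ]

theorem prod_ite_eq_apply {ι α : Type*} [Fintype ι] [DecidableEq α]
    (b b' : ι → α) (e : ι → ℂ) :
    ∏ i, (if b i = b' i then e i else 0) = if b = b' then ∏ i, e i else 0 := by
  split_ifs with h
  · simp [h]
  · obtain ⟨i, hi⟩ := Function.ne_iff.mp h
    exact Finset.prod_eq_zero (Finset.mem_univ i) (if_neg hi)

/-- The question-register vectors, indexed by `b`, onto whose span the test projects when the
answer outcomes are `r`; the vector is zero unless `b` vanishes on the zero set of `r`. -/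
noncomputable def questionVec (K' Q k : ℕ) (r : Fin k → Fin K') (b q : Fin k → Fin Q) : ℂ :=
  ∏ i, if (r i : ℕ) = 0 then fourierAmp Q 0 (q i) * (if (b i : ℕ) = 0 then 1 else 0)
    else (if q i = b i then 1 else 0)

/-- The question-register state (unnormalized) left after the answer outcomes `r`. -/
noncomputable def condAmp {K' Q k : ℕ} (ψ : (Fin k → Fin Q) → (Fin k → Fin K') → ℂ)
    (r : Fin k → Fin K') (q : Fin k → Fin Q) : ℂ :=
  ∑ a : Fin k → Fin K', ψ q a * ∏ i, conj (fourierAmp K' (r i) (a i))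

theorem unifOverlap_eq {K' Q k : ℕ} (ψ : (Fin k → Fin Q) → (Fin k → Fin K') → ℂ)
    (r : Fin k → Fin K') (b : Fin k → Fin Q) :
    unifOverlap K' Q k r b ψ = ∑ q, condAmp ψ r q * conj (questionVec K' Q k r b q) := by
  unfold unifOverlap condAmp
  refine Finset.sum_congr rfl fun q _ => ?_
  rw [Finset.sum_mul]
  refine Finset.sum_congr rfl fun a _ => ?_
  congr 1
  rw [questionVec, map_prod]
  refine Finset.prod_congr rfl fun i _ => ?_
  split_ifs <;> simp

theorem questionVec_congr {K' Q k : ℕ} (r : Fin k → Fin K') (b : Fin k → Fin Q)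
    {q q' : Fin k → Fin Q} (h : ∀ i, (r i : ℕ) ≠ 0 → q i = q' i) :
    questionVec K' Q k r b q = questionVec K' Q k r b q' := by
  refine Finset.prod_congr rfl fun i _ => ?_
  by_cases hi : (r i : ℕ) = 0
  · simp only [hi, if_true, fourierAmp_zero_left]
  · simp only [hi, if_false, h i hi]

theorem sum_questionVec_mul_conj {K' Q k : ℕ} (hQ : 0 < Q) (r : Fin k → Fin K')
    (b b' : Fin k → Fin Q) :
    ∑ q, questionVec K' Q k r b q * conj (questionVec K' Q k r b' q) =
      if b = b' then ∏ i, (if (r i : ℕ) = 0 ∧ (b i : ℕ) ≠ 0 then (0 : ℂ) else 1) else 0 := by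
  have hQ0 : (Q : ℂ) ≠ 0 := by exact_mod_cast hQ.ne'
  rw [← prod_ite_eq_apply]
  simp only [questionVec, map_prod]
  rw [sum_prod_mul_prod (fun i (c : Fin Q) => if (r i : ℕ) = 0 then
    fourierAmp Q 0 c * (if (b i : ℕ) = 0 then 1 else 0) else (if c = b i then 1 else 0))
    (fun i (c : Fin Q) => conj (if (r i : ℕ) = 0 then
    fourierAmp Q 0 c * (if (b' i : ℕ) = 0 then 1 else 0) else (if c = b' i then 1 else 0)))]
  refine Finset.prod_congr rfl fun i _ => ?_
  by_cases hr : (r i : ℕ) = 0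
  · have hamp : ∀ c : Fin Q, fourierAmp Q 0 c * conj (fourierAmp Q 0 c) = 1 / Q := fun c => by
      rw [fourierAmp_zero_left, map_div₀, Complex.conj_ofReal, map_one, div_mul_div_comm,
        sqrt_mul_sqrt_natCast, mul_one]
    by_cases hb : (b i : ℕ) = 0 <;> by_cases hb' : (b' i : ℕ) = 0
    · have : b i = b' i := Fin.ext (hb.trans hb'.symm)
      simp [hr, hb', hamp, hQ0, this]
    · have : b i ≠ b' i := fun h => hb' (h ▸ hb)
      simp [hr, hb', this]
    · simp [hr, hb]
    · simp [hr, hb]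
  · simp only [hr, if_false, false_and]
    by_cases hbb : b i = b' i
    · simp [hbb]
    · simp [hbb, Ne.symm hbb]

/-- Bessel's inequality for the projection in step 3, with the residual made explicit. -/
theorem sum_normSq_condAmp_sub {K' Q k : ℕ} (hQ : 0 < Q)
    (ψ : (Fin k → Fin Q) → (Fin k → Fin K') → ℂ) (r : Fin k → Fin K') :
    ∑ q, Complex.normSq (condAmp ψ r q -
        ∑ b, unifOverlap K' Q k r b ψ * questionVec K' Q k r b q) =
      ∑ q, Complex.normSq (condAmp ψ r q) - ∑ b, Complex.normSq (unifOverlap K' Q k r b ψ) := by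
  simp only [unifOverlap_eq]
  refine sum_normSq_sub_projection _ _ (sum_questionVec_mul_conj hQ r) _ fun b => ?_
  by_cases h : ∃ i, (r i : ℕ) = 0 ∧ (b i : ℕ) ≠ 0
  · obtain ⟨i, hi⟩ := h
    have hzero : ∀ q, questionVec K' Q k r b q = 0 := fun q =>
      Finset.prod_eq_zero (Finset.mem_univ i) (by simp [hi.1, hi.2])
    simp [hzero]
  · push Not at h
    rw [Finset.prod_eq_one, one_mul]
    intro i _
    rw [if_neg]
    exact fun hi => hi.2 (h i hi.1)

theorem sum_unifOverlap_le {K' Q k : ℕ} (hQ : 0 < Q)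
    (ψ : (Fin k → Fin Q) → (Fin k → Fin K') → ℂ) (r : Fin k → Fin K') :
    ∑ b, Complex.normSq (unifOverlap K' Q k r b ψ) ≤ ∑ q, Complex.normSq (condAmp ψ r q) := by
  rw [← sub_nonneg, ← sum_normSq_condAmp_sub hQ]
  exact Finset.sum_nonneg fun _ _ => Complex.normSq_nonneg _

theorem condAmp_congr_of_eq {K' Q k : ℕ} (hQ : 0 < Q)
    (ψ : (Fin k → Fin Q) → (Fin k → Fin K') → ℂ) (r : Fin k → Fin K')
    (heq : ∑ b, Complex.normSq (unifOverlap K' Q k r b ψ) =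
      ∑ q, Complex.normSq (condAmp ψ r q))
    {q q' : Fin k → Fin Q} (h : ∀ i, (r i : ℕ) ≠ 0 → q i = q' i) :
    condAmp ψ r q = condAmp ψ r q' := by
  have hres := sum_normSq_condAmp_sub hQ ψ r
  rw [heq, sub_self, Finset.sum_eq_zero_iff_of_nonneg fun _ _ => Complex.normSq_nonneg _] at hres
  have hproj : ∀ q, condAmp ψ r q = ∑ b, unifOverlap K' Q k r b ψ * questionVec K' Q k r b q :=
    fun q => sub_eq_zero.mp (Complex.normSq_eq_zero.mp (hres q (Finset.mem_univ q)))
  rw [hproj q, hproj q']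
  exact Finset.sum_congr rfl fun b _ => by rw [questionVec_congr r b h]

theorem sum_normSq_condAmp {K' Q k : ℕ} (hK' : 0 < K')
    (ψ : (Fin k → Fin Q) → (Fin k → Fin K') → ℂ) (q : Fin k → Fin Q) :
    ∑ r, Complex.normSq (condAmp ψ r q) = questionDist ψ q := by
  have complete : ∀ a a' : Fin k → Fin K',
      ∑ r : Fin k → Fin K', (∏ i, conj (fourierAmp K' (r i) (a i))) *
        conj (∏ i, conj (fourierAmp K' (r i) (a' i))) = if a = a' then 1 else 0 := fun a a' => by
    simp only [map_prod, Complex.conj_conj]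
    rw [sum_prod_mul_prod (fun i (c : Fin K') => conj (fourierAmp K' c (a i)))
      (fun i (c : Fin K') => fourierAmp K' c (a' i))]
    simp only [sum_conj_fourierAmp_mul K' hK']
    rw [prod_ite_eq_apply a a' fun _ => 1]
    simp
  exact sum_normSq_eq_of_complete _ complete (ψ q)

/-- If a pure state ψ passes the uniformity test with probability 1, then the
standard-basis distribution on its question registers is a mixture, over large subsets
`T ⊆ [k]` with `|T| ≥ (k/K')(1-η)`, of (uniform on `T`) ⊗ (arbitrary junk on the complement). -/
theorem uniformity_test_zero_error
    (K' Q k : ℕ) (hK' : 0 < K') (hQ : 0 < Q)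
    (η : ℝ) (hη0 : 0 < η) (hη1 : η < 1)
    (ψ : (Fin k → Fin Q) → (Fin k → Fin K') → ℂ)
    (hnorm : ∑ q : Fin k → Fin Q, ∑ a : Fin k → Fin K', Complex.normSq (ψ q a) = 1)
    (hpass : unifPassProb K' Q k η ψ = 1) :
    ∃ (S : Finset (Finset (Fin k))) (p : Finset (Fin k) → ℝ)
      (g : Finset (Fin k) → (Fin k → Fin Q) → ℝ),
      (∀ T ∈ S, ((k : ℝ) / (K' : ℝ)) * (1 - η) ≤ (T.card : ℝ)) ∧
      (∀ T ∈ S, 0 ≤ p T) ∧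
      (∑ T ∈ S, p T = 1) ∧
      (∀ T ∈ S, ∀ q, 0 ≤ g T q) ∧
      (∀ T ∈ S, ∀ q q' : Fin k → Fin Q, (∀ i, i ∉ T → q i = q' i) → g T q = g T q') ∧
      (∀ T ∈ S, ∑ q : Fin k → Fin Q, (1 / (Q : ℝ)) ^ T.card * g T q = 1) ∧
      (∀ q, questionDist ψ q = ∑ T ∈ S, p T * ((1 / (Q : ℝ)) ^ T.card * g T q)) := by
  set Z : (Fin k → Fin K') → Finset (Fin k) :=
    fun r => Finset.univ.filter fun i => (r i : ℕ) = 0 with hZ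
  set N : (Fin k → Fin K') → ℝ := fun r => ∑ q, Complex.normSq (condAmp ψ r q) with hN
  have hN0 : ∀ r, 0 ≤ N r := fun r => Finset.sum_nonneg fun _ _ => Complex.normSq_nonneg _
  have hNsum : ∑ r, N r = 1 := by
    rw [hN, Finset.sum_comm]
    simp only [sum_normSq_condAmp hK']
    exact hnorm
  have hterm : ∀ r, (if (1 - η) / (K' : ℝ) * k ≤ ((Z r).card : ℝ) then
      ∑ b, Complex.normSq (unifOverlap K' Q k r b ψ) else 0) = N r := by
    have hle : ∀ r ∈ Finset.univ, (if (1 - η) / (K' : ℝ) * k ≤ ((Z r).card : ℝ) then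
        ∑ b, Complex.normSq (unifOverlap K' Q k r b ψ) else 0) ≤ N r := fun r _ => by
      split_ifs
      · exact sum_unifOverlap_le hQ ψ r
      · exact hN0 r
    have hsum := (Finset.sum_eq_sum_iff_of_le hle).mp (hpass.trans hNsum.symm)
    exact fun r => hsum r (Finset.mem_univ r)
  have hgood : ∀ r, N r ≠ 0 → (1 - η) / (K' : ℝ) * k ≤ ((Z r).card : ℝ) := fun r hr => by
    by_contra hbad
    exact hr (by rw [← hterm r, if_neg hbad])
  have hinv : ∀ r, ∀ q q' : Fin k → Fin Q, (∀ i, i ∉ Z r → q i = q' i) →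
      Complex.normSq (condAmp ψ r q) = Complex.normSq (condAmp ψ r q') := fun r q q' h => by
    by_cases hr : N r = 0
    · have hzero := (Finset.sum_eq_zero_iff_of_nonneg
        fun _ _ => Complex.normSq_nonneg _).mp hr
      rw [hzero q (Finset.mem_univ q), hzero q' (Finset.mem_univ q')]
    · have heq := hterm r
      rw [if_pos (hgood r hr)] at heq
      rw [condAmp_congr_of_eq hQ ψ r heq fun i hi => h i (by simpa [hZ] using hi)]
  set w : Finset (Fin k) → (Fin k → Fin Q) → ℝ :=
    fun T q => ∑ r with Z r = T, Complex.normSq (condAmp ψ r q) with hw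
  set p : Finset (Fin k) → ℝ := fun T => ∑ q, w T q with hp
  have hw0 : ∀ T q, 0 ≤ w T q := fun T q =>
    Finset.sum_nonneg fun _ _ => Complex.normSq_nonneg _
  have hp0 : ∀ T, 0 ≤ p T := fun T => Finset.sum_nonneg fun q _ => hw0 T q
  have hpN : ∀ T, p T = ∑ r with Z r = T, N r := fun T => Finset.sum_comm
  have hQ0 : (1 / (Q : ℝ)) ≠ 0 := one_div_ne_zero (by exact_mod_cast hQ.ne')
  have hscale : ∀ (T : Finset (Fin k)) (q : Fin k → Fin Q),
      (1 / (Q : ℝ)) ^ T.card * (w T q / (p T * (1 / (Q : ℝ)) ^ T.card)) = w T q / p T :=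
    fun T q => by
      have := pow_ne_zero T.card hQ0
      rw [mul_comm (p T), ← mul_div_assoc, mul_div_mul_left _ _ this]
  refine ⟨Finset.univ.filter fun T => p T ≠ 0, p,
    fun T q => w T q / (p T * (1 / (Q : ℝ)) ^ T.card), ?_, ?_, ?_, ?_, ?_, ?_, ?_⟩
  · intro T hT
    have hT' : p T ≠ 0 := (Finset.mem_filter.mp hT).2
    rw [hpN] at hT'
    obtain ⟨r, hr, hr0⟩ := Finset.exists_ne_zero_of_sum_ne_zero hT'
    have hcard := hgood r hr0
    rw [(Finset.mem_filter.mp hr).2] at hcard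
    calc (k : ℝ) / K' * (1 - η) = (1 - η) / K' * k := by ring
      _ ≤ _ := hcard
  · exact fun T _ => hp0 T
  · rw [Finset.sum_filter_ne_zero]
    simp only [hpN]
    rw [Finset.sum_fiberwise, hNsum]
  · exact fun T _ q => div_nonneg (hw0 T q) (mul_nonneg (hp0 T) (by positivity))
  · intro T _ q q' h
    have hwT : w T q = w T q' := Finset.sum_congr rfl fun r hr =>
      hinv r q q' (by rwa [(Finset.mem_filter.mp hr).2])
    simp only [hwT]
  · intro T hT
    simp only [hscale]
    rw [← Finset.sum_div]
    exact div_self (Finset.mem_filter.mp hT).2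
  · intro q
    simp only [hscale]
    have hcancel : ∀ T, p T * (w T q / p T) = w T q := fun T => by
      by_cases hT : p T = 0
      · have := (Finset.sum_eq_zero_iff_of_nonneg fun q _ => hw0 T q).mp hT q (Finset.mem_univ q)
        rw [this, zero_div, mul_zero]
      · exact mul_div_cancel₀ _ hT
    rw [Finset.sum_filter_of_ne (p := fun T => p T ≠ 0)
      fun T _ h h0 => h (by rw [h0, zero_mul])]
    simp only [hcancel]
    rw [← sum_normSq_condAmp hK']
    exact (Finset.sum_fiberwise _ _ _).symm
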